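/- Let p, q be integers such that 5 does not divide p and p ≡ q (mod 5), and let n ≥ 1. Then the generalized Fibonacci–Lucas quaternion G^{p,q}_n is a zero divisor in H[Z_5] (equivalently, not a unit) if and only if n ≡ 4 (mod 5). -/

import Mathlib

open Quaternion

/-- The Lucas sequence, as integers: `l_n = 2·f_{n+1} - f_n`
(equivalently `l_0 = 2`, `l_1 = 1`, `l_{n+2} = l_{n+1} + l_n`). -/
def lucas (n : ℕ) : ℤ := 2 * (Nat.fib (n + 1) : ℤ) - (Nat.fib n : ℤ)

/-- The generalized Fibonacci–Lucas numbers `g^{p,q}_n = p·f_{n-1} + q·l_n` (for `n ≥ 1`). -/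
def genFL (p q : ℤ) (n : ℕ) : ℤ := p * (Nat.fib (n - 1) : ℤ) + q * lucas n

/-- The n-th generalized Fibonacci–Lucas quaternion over a commutative ring `R`:
`G^{p,q}_n = g^{p,q}_n + g^{p,q}_{n+1}·i + g^{p,q}_{n+2}·j + g^{p,q}_{n+3}·k` in `ℍ[R]`. -/
def genFLQuat (R : Type*) [CommRing R] (p q : ℤ) (n : ℕ) : ℍ[R] :=
  ⟨(genFL p q n : R), (genFL p q (n + 1) : R), (genFL p q (n + 2) : R), (genFL p q (n + 3) : R)⟩

/-- A quaternion over a commutative ring is a unit exactly when its norm is. -/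
theorem Quaternion.isUnit_iff_isUnit_normSq {R : Type*} [CommRing R] (a : ℍ[R]) :
    IsUnit a ↔ IsUnit (Quaternion.normSq a) := by
  refine ⟨fun h => h.map _, fun h => ?_⟩
  have hcoe : IsUnit ((Quaternion.normSq a : R) : ℍ[R]) := h.map (algebraMap R ℍ[R])
  have hcomm : Commute a (star a) := (Quaternion.self_mul_star a).trans (Quaternion.star_mul_self a).symm
  rw [← Quaternion.self_mul_star, hcomm.isUnit_mul_iff] at hcoe
  exact hcoe.1

theorem Nat.five_dvd_fib_iff (k : ℕ) : 5 ∣ Nat.fib k ↔ 5 ∣ k := by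
  refine ⟨fun h => ?_, fun h => Nat.fib_dvd 5 k h⟩
  by_contra hk
  have hcop : Nat.gcd 5 k = 1 := (Nat.Prime.coprime_iff_not_dvd (by norm_num)).2 hk
  have hgcd := Nat.fib_gcd 5 k
  rw [hcop, Nat.gcd_eq_left (show Nat.fib 5 ∣ Nat.fib k from h)] at hgcd
  exact absurd hgcd (by decide)

/-- Modulo 5 the Lucas numbers form a geometric progression of ratio 3. -/
theorem lucas_succ_zmod_five (n : ℕ) : (lucas (n + 1) : ZMod 5) = 3 * (lucas n : ZMod 5) := by
  have h5 : (5 : ZMod 5) = 0 := by decide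
  simp only [lucas, Nat.fib_add_two]
  push_cast
  linear_combination ((Nat.fib n : ZMod 5) - (Nat.fib (n + 1) : ZMod 5)) * h5

theorem lucas_zmod_five_ne_zero (n : ℕ) : (lucas n : ZMod 5) ≠ 0 := by
  have : Fact (Nat.Prime 5) := ⟨by norm_num⟩
  induction n with
  | zero => decide
  | succ n ih =>
    rw [lucas_succ_zmod_five]
    exact mul_ne_zero (by decide) ih

theorem genFL_succ (p q : ℤ) (n : ℕ) :
    genFL p q (n + 1) = (p + 2 * q) * Nat.fib n + q * Nat.fib (n + 1) := by
  simp only [genFL, lucas, Nat.add_sub_cancel, Nat.fib_add_two]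
  push_cast
  ring

/-- If `p ≡ q (mod 5)`, the norm of the quaternion `G^{p,q}_n` is `3 p² f_{n+1} l_n` modulo 5. -/
theorem normSq_genFLQuat_zmod_five {p q : ℤ} (hpq : (p : ZMod 5) = q) {n : ℕ} (hn : 1 ≤ n) :
    Quaternion.normSq (genFLQuat (ZMod 5) p q n) =
      3 * (p : ZMod 5) ^ 2 * (Nat.fib (n + 1) : ZMod 5) * (lucas n : ZMod 5) := by
  obtain ⟨m, rfl⟩ := Nat.exists_eq_add_of_le' hn
  have h5 : (5 : ZMod 5) = 0 := by decide
  have f2 : Nat.fib (m + 2) = Nat.fib m + Nat.fib (m + 1) := Nat.fib_add_two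
  have f3 : Nat.fib (m + 3) = Nat.fib (m + 1) + Nat.fib (m + 2) := Nat.fib_add_two
  have f4 : Nat.fib (m + 4) = Nat.fib (m + 2) + Nat.fib (m + 3) := Nat.fib_add_two
  rw [Quaternion.normSq_def']
  simp only [genFLQuat, add_assoc, Nat.reduceAdd]
  rw [genFL_succ p q m, genFL_succ p q (m + 1), genFL_succ p q (m + 2), genFL_succ p q (m + 3)]
  simp only [lucas, add_assoc, Nat.reduceAdd, f4, f3, f2]
  push_cast
  rw [← hpq]
  generalize (Nat.fib m : ZMod 5) = x
  generalize (Nat.fib (m + 1) : ZMod 5) = y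
  generalize (p : ZMod 5) = r
  linear_combination r ^ 2 * (27 * x * y + 9 * x ^ 2 + 24 * y ^ 2) * h5

theorem genFLQuat_zmod_five_p_eq_q (p q : ℤ) (hp : ¬ (5 : ℤ) ∣ p) (hpq : p % 5 = q % 5)
    (n : ℕ) (hn : 1 ≤ n) :
    ¬ IsUnit (genFLQuat (ZMod 5) p q n) ↔ n % 5 = 4 := by
  have h3 : (3 : ZMod 5) ≠ 0 := by decide
  have : Fact (Nat.Prime 5) := ⟨by norm_num⟩
  have hp0 : (p : ZMod 5) ≠ 0 := fun h => hp ((ZMod.intCast_zmod_eq_zero_iff_dvd p 5).1 h)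
  have hpq' : (p : ZMod 5) = q := (ZMod.intCast_eq_intCast_iff p q 5).2 hpq
  rw [Quaternion.isUnit_iff_isUnit_normSq, normSq_genFLQuat_zmod_five hpq' hn, isUnit_iff_ne_zero,
    not_not]
  simp only [mul_eq_zero, pow_eq_zero_iff two_ne_zero, h3, hp0, lucas_zmod_five_ne_zero, false_or,
    or_false]
  rw [ZMod.natCast_eq_zero_iff, Nat.five_dvd_fib_iff]
  omega
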